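/- Let g be a polynomial with complex coefficients. Then (1/2π)∫_{-∞}^{∞} [Re g(π/2+it) + Re g(−π/2+it)] dt/cosh(t) = Re g(0). -/

import Mathlib

open Real MeasureTheory Complex Polynomial

open Filter Topology Set in
lemma Real.integrable_exp_neg_abs_div_two : Integrable fun t : ℝ ↦ Real.exp (-|t| / 2) := by
  rw [← integrableOn_univ, ← Iic_union_Ioi (a := (0 : ℝ))]
  refine IntegrableOn.union ?_ ?_
  · refine (integrableOn_exp_mul_Iic (a := 1 / 2) (by norm_num) 0).congr_fun ?_ measurableSet_Iic
    intro t ht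
    simp only [mem_Iic] at ht
    simp only [abs_of_nonpos ht]
    ring_nf
  · refine (integrableOn_exp_mul_Ioi (a := -(1 / 2)) (by norm_num) 0).congr_fun ?_ measurableSet_Ioi
    intro t ht
    simp only [mem_Ioi] at ht
    simp only [abs_of_pos ht]
    ring_nf

lemma Real.exp_abs_div_two_div_cosh_le (t : ℝ) :
    Real.exp (|t| / 2) / Real.cosh t ≤ 2 * Real.exp (-|t| / 2) := by
  rw [div_le_iff₀ (Real.cosh_pos t), ← Real.cosh_abs, Real.cosh_eq]
  have h : Real.exp (|t| / 2) = Real.exp (-|t| / 2) * Real.exp |t| := by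
    rw [← Real.exp_add]; ring_nf
  have := mul_pos (Real.exp_pos (-|t| / 2)) (Real.exp_pos (-|t|))
  linarith

lemma Real.exp_div_four_le_sinh {t : ℝ} (ht : 1 ≤ t) : Real.exp t / 4 ≤ Real.sinh t := by
  have h1 : 2 ≤ Real.exp t := by linarith [Real.add_one_le_exp t]
  have h2 : Real.exp (-t) ≤ 1 := Real.exp_le_one_iff.2 (by linarith)
  rw [Real.sinh_eq]
  linarith

lemma Complex.abs_sinh_im_le_norm_sin (z : ℂ) : |Real.sinh z.im| ≤ ‖Complex.sin z‖ := by
  rw [Complex.norm_def]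
  refine Real.abs_le_sqrt ?_
  have h : Complex.sin z = ⟨Real.sin z.re * Real.cosh z.im, Real.cos z.re * Real.sinh z.im⟩ := by
    rw [Complex.sin_eq, ← Complex.ofReal_sin, ← Complex.ofReal_cosh, ← Complex.ofReal_cos,
      ← Complex.ofReal_sinh]
    apply Complex.ext <;> simp [-Complex.ofReal_sin, -Complex.ofReal_cosh, -Complex.ofReal_cos,
      -Complex.ofReal_sinh]
  rw [h, Complex.normSq_mk]
  nlinarith [Real.cosh_sq z.im, Real.sin_sq_add_cos_sq z.re, sq_nonneg (Real.sin z.re)]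

/-- On a vertical strip a polynomial grows slower than any exponential of the imaginary part. -/
lemma Polynomial.exists_norm_eval_le_exp_abs_im (p : Polynomial ℂ) (a : ℝ) :
    ∃ C, 0 ≤ C ∧ ∀ z : ℂ, |z.re| ≤ a → ‖p.eval z‖ ≤ C * Real.exp (|z.im| / 2) := by
  induction p using Polynomial.induction_on' with
  | add p q hp hq =>
    obtain ⟨C, hC0, hC⟩ := hp
    obtain ⟨D, hD0, hD⟩ := hq
    refine ⟨C + D, by positivity, fun z hz ↦ ?_⟩
    rw [Polynomial.eval_add, add_mul]
    exact (norm_add_le _ _).trans (add_le_add (hC z hz) (hD z hz))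
  | monomial n c =>
    refine ⟨‖c‖ * (2 ^ n * n.factorial * Real.exp (a / 2)), by positivity, fun z hz ↦ ?_⟩
    rw [Polynomial.eval_monomial, norm_mul, norm_pow, mul_assoc]
    gcongr
    have h1 : ‖z‖ ≤ a + |z.im| := (Complex.norm_le_abs_re_add_abs_im z).trans (by linarith)
    have h2 := Real.pow_div_factorial_le_exp (‖z‖ / 2) (by positivity) n
    rw [div_le_iff₀ (by positivity), div_pow, div_le_iff₀ (by positivity)] at h2
    have h3 : Real.exp (‖z‖ / 2) ≤ Real.exp (a / 2) * Real.exp (|z.im| / 2) := by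
      rw [← Real.exp_add]
      gcongr
      linarith
    calc ‖z‖ ^ n ≤ Real.exp (‖z‖ / 2) * n.factorial * 2 ^ n := h2
      _ ≤ Real.exp (a / 2) * Real.exp (|z.im| / 2) * n.factorial * 2 ^ n := by gcongr
      _ = _ := by ring

lemma Polynomial.integrable_eval_add_mul_I_div_cosh (p : Polynomial ℂ) (x : ℝ) :
    Integrable fun t : ℝ ↦ p.eval (x + t * Complex.I) / (Real.cosh t : ℂ) := by
  obtain ⟨C, hC0, hC⟩ := p.exists_norm_eval_le_exp_abs_im |x|
  refine (Real.integrable_exp_neg_abs_div_two.const_mul (C * 2)).mono' ?_ (.of_forall fun t ↦ ?_)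
  · refine Continuous.aestronglyMeasurable (Continuous.div ?_ ?_ ?_)
    · exact p.continuous.comp (by fun_prop)
    · exact Complex.continuous_ofReal.comp Real.continuous_cosh
    · exact fun t ↦ Complex.ofReal_ne_zero.2 (Real.cosh_pos t).ne'
  · have h := hC (x + t * Complex.I) (by simp)
    simp only [Complex.add_im, Complex.ofReal_im, Complex.mul_im, Complex.ofReal_re, Complex.I_im,
      Complex.I_re, mul_one, mul_zero, add_zero, zero_add] at h
    rw [norm_div, Complex.norm_real, Real.norm_of_nonneg (Real.cosh_pos t).le]
    calc _ ≤ C * Real.exp (|t| / 2) / Real.cosh t :=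
          div_le_div_of_nonneg_right h (Real.cosh_pos t).le
      _ = C * (Real.exp (|t| / 2) / Real.cosh t) := by ring
      _ ≤ C * (2 * Real.exp (-|t| / 2)) := by gcongr; exact Real.exp_abs_div_two_div_cosh_le t
      _ = _ := by ring

open Filter Topology in
lemma Real.integral_inv_cosh : ∫ t : ℝ, (Real.cosh t)⁻¹ = π := by
  have hint : Integrable fun t : ℝ ↦ (Real.cosh t)⁻¹ := by
    have := ((1 : Polynomial ℂ).integrable_eval_add_mul_I_div_cosh 0).re
    refine this.congr (.of_forall fun t ↦ ?_)
    simp only [Polynomial.eval_one, one_div, ← Complex.ofReal_inv]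
    rfl
  have htop : Tendsto Real.sinh atTop atTop :=
    Real.sinhOrderIso.tendsto_atTop
  have hbot : Tendsto Real.sinh atBot atBot :=
    Real.sinhOrderIso.tendsto_atBot
  have h := integral_of_hasDerivAt_of_tendsto (f := fun t ↦ Real.arctan (Real.sinh t))
    (f' := fun t ↦ (Real.cosh t)⁻¹) (m := -(π / 2)) (n := π / 2) (fun t ↦ ?_) hint
    ((tendsto_nhds_of_tendsto_nhdsWithin Real.tendsto_arctan_atBot).comp hbot)
    ((tendsto_nhds_of_tendsto_nhdsWithin Real.tendsto_arctan_atTop).comp htop)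
  · rw [h]; ring
  · refine (Real.hasDerivAt_sinh t).arctan.congr_deriv ?_
    have := (Real.cosh_pos t).ne'
    rw [add_comm, ← Real.cosh_sq]
    field_simp

lemma Complex.sin_ne_zero_of_abs_re_lt {z : ℂ} (hz : |z.re| < π) (h0 : z ≠ 0) :
    Complex.sin z ≠ 0 := by
  rw [Complex.sin_ne_zero_iff]
  rintro k rfl
  have h : |(k : ℝ)| * π < 1 * π := by
    have : ((k : ℂ) * (π : ℂ)).re = k * π := by simp
    rwa [this, abs_mul, abs_of_pos Real.pi_pos, ← one_mul π, ← mul_assoc, mul_one] at hz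
  have h' : |k| < 1 := by exact_mod_cast lt_of_mul_lt_mul_right h Real.pi_pos.le
  rw [Int.abs_lt_one_iff] at h'
  simp [h'] at h0

lemma Complex.dslope_sin_zero_ne_zero {z : ℂ} (hz : |z.re| < π) :
    dslope Complex.sin 0 z ≠ 0 := by
  rcases eq_or_ne z 0 with rfl | h0
  · simp [dslope_same]
  · rw [dslope_of_ne _ h0, slope_def_field]
    simpa using ⟨Complex.sin_ne_zero_of_abs_re_lt hz h0, h0⟩

lemma Complex.differentiable_dslope_sin_zero : Differentiable ℂ (dslope Complex.sin 0) := by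
  rw [← differentiableOn_univ, Complex.differentiableOn_dslope Filter.univ_mem]
  exact Complex.differentiable_sin.differentiableOn

lemma Polynomial.eval_div_dslope_sin (q : Polynomial ℂ) {z : ℂ} (h0 : z ≠ 0) :
    q.eval z / dslope Complex.sin 0 z = (X * q).eval z / Complex.sin z := by
  rw [dslope_of_ne _ h0, slope_def_field]
  simp
  field_simp

open Filter Topology Set in
/-- The total integral over the two sides of the strip `|Re z| ≤ π / 2` is zero for a polynomial
vanishing at the origin, since `z / sin z` is holomorphic there. -/
lemma Polynomial.integral_eval_strip_X_mul (q : Polynomial ℂ) :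
    ∫ t : ℝ, ((X * q).eval (((π / 2 : ℝ) : ℂ) + t * Complex.I) / (Real.cosh t : ℂ)
      + (X * q).eval (((-(π / 2) : ℝ) : ℂ) + t * Complex.I) / (Real.cosh t : ℂ)) = 0 := by
  have hπ := Real.pi_pos
  set h : ℂ → ℂ := fun z ↦ q.eval z / dslope Complex.sin 0 z with hh
  obtain ⟨C, hC0, hC⟩ := (X * q).exists_norm_eval_le_exp_abs_im (π / 2)
  have hright (t : ℝ) : h (((π / 2 : ℝ) : ℂ) + t * Complex.I)
      = (X * q).eval (((π / 2 : ℝ) : ℂ) + t * Complex.I) / (Real.cosh t : ℂ) := by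
    rw [hh]
    dsimp only
    rw [Polynomial.eval_div_dslope_sin]
    · congr 1
      rw [Complex.sin_add_mul_I, ← Complex.ofReal_sin, ← Complex.ofReal_cos]
      simp
    · intro h0
      have := congrArg Complex.re h0
      simp at this
  have hleft (t : ℝ) : h (((-(π / 2) : ℝ) : ℂ) + t * Complex.I)
      = -((X * q).eval (((-(π / 2) : ℝ) : ℂ) + t * Complex.I) / (Real.cosh t : ℂ)) := by
    rw [hh]
    dsimp only
    rw [Polynomial.eval_div_dslope_sin, ← div_neg (_ : ℂ)]
    · congr 1
      rw [Complex.sin_add_mul_I, ← Complex.ofReal_sin, ← Complex.ofReal_cos, Real.sin_neg,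
        Real.cos_neg]
      simp
    · intro h0
      have := congrArg Complex.re h0
      simp at this
  have hhor (x T : ℝ) (hx : |x| ≤ π / 2) (hT : 1 ≤ |T|) :
      ‖h (x + T * Complex.I)‖ ≤ 4 * C * Real.exp (-|T| / 2) := by
    have h0 : (x + T * Complex.I : ℂ) ≠ 0 := by
      intro h0
      have := congrArg Complex.im h0
      simp at this
      norm_num [this] at hT
    have him : (x + T * Complex.I : ℂ).im = T := by simp
    have h1 := hC (x + T * Complex.I) (by simpa using hx)
    have h2 := Complex.abs_sinh_im_le_norm_sin (x + T * Complex.I)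
    rw [him] at h1 h2
    rw [Real.abs_sinh] at h2
    have h3 := (Real.exp_div_four_le_sinh hT).trans h2
    rw [hh]
    dsimp only
    rw [Polynomial.eval_div_dslope_sin _ h0, norm_div]
    have hpos := Real.exp_pos |T|
    rw [div_le_iff₀ (by linarith)]
    calc _ ≤ C * Real.exp (|T| / 2) := h1
      _ = 4 * C * Real.exp (-|T| / 2) * (Real.exp |T| / 4) := by
        have : Real.exp (|T| / 2) = Real.exp (-|T| / 2) * Real.exp |T| := by
          rw [← Real.exp_add]; ring_nf
        rw [this]; ring
      _ ≤ _ := by gcongr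
  set F : ℝ → ℂ := fun t ↦ (X * q).eval (((π / 2 : ℝ) : ℂ) + t * Complex.I) / (Real.cosh t : ℂ)
  set G : ℝ → ℂ := fun t ↦ (X * q).eval (((-(π / 2) : ℝ) : ℂ) + t * Complex.I)
      / (Real.cosh t : ℂ)
  have hFi : Integrable F := (X * q).integrable_eval_add_mul_I_div_cosh (π / 2)
  have hGi : Integrable G := (X * q).integrable_eval_add_mul_I_div_cosh (-(π / 2))
  have hlim := intervalIntegral_tendsto_integral (hFi.add hGi) tendsto_neg_atTop_atBot tendsto_id
  refine tendsto_nhds_unique hlim ?_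
  have hbound : Tendsto (fun T : ℝ ↦ 8 * C * π * Real.exp (-(T / 2))) atTop (𝓝 0) := by
    have := (Real.tendsto_exp_neg_atTop_nhds_zero.comp
      (tendsto_id.atTop_div_const (two_pos (α := ℝ)))).const_mul (8 * C * π)
    simpa using this
  refine squeeze_zero_norm' ?_ hbound
  filter_upwards [eventually_ge_atTop 1] with T hT
  have hrect := Complex.integral_boundary_rect_eq_zero_of_differentiableOn h
    ⟨-(π / 2), -T⟩ ⟨π / 2, T⟩ (by
      intro z hz
      rw [Complex.mem_reProdIm, uIcc_of_le (show -(π / 2) ≤ π / 2 by linarith)] at hz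
      have hz' : |z.re| < π := (abs_le.2 hz.1).trans_lt (by linarith)
      exact (q.differentiable.differentiableAt.div
        Complex.differentiable_dslope_sin_zero.differentiableAt
        (Complex.dslope_sin_zero_ne_zero hz')).differentiableWithinAt)
  simp only [hright, hleft, intervalIntegral.integral_neg] at hrect
  have hb (S : ℝ) (hS : |S| = T) :
      ‖∫ x : ℝ in (-(π / 2))..(π / 2), h (x + S * Complex.I)‖ ≤ 4 * C * Real.exp (-T / 2) * π := by
    have := intervalIntegral.norm_integral_le_of_norm_le_const (a := -(π / 2)) (b := π / 2)
      (f := fun x : ℝ ↦ h (x + S * Complex.I)) (C := 4 * C * Real.exp (-T / 2)) (by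
        intro x hx
        rw [uIoc_of_le (by linarith)] at hx
        rw [← hS]
        exact hhor x S (abs_le.2 ⟨hx.1.le, hx.2⟩) (by linarith))
    convert this using 2
    rw [abs_of_pos (by linarith)]
    ring
  have hb1 := hb T (abs_of_pos (by linarith))
  have hb2 := hb (-T) (by rw [abs_neg, abs_of_pos (by linarith)])
  set A := ∫ x : ℝ in (-(π / 2))..(π / 2), h (x + T * Complex.I)
  set B := ∫ x : ℝ in (-(π / 2))..(π / 2), h (x + (-T : ℝ) * Complex.I)
  have hsum : ∫ t in (-T)..T, (F + G) t = (∫ t in (-T)..T, F t) + ∫ t in (-T)..T, G t :=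
    intervalIntegral.integral_add hFi.intervalIntegrable hGi.intervalIntegrable
  have heq : Complex.I * ∫ t in (-T)..T, (F + G) t = A - B := by
    rw [hsum]
    simp only [smul_eq_mul] at hrect
    linear_combination hrect
  have hnorm := congrArg norm heq
  rw [norm_mul, Complex.norm_I, one_mul] at hnorm
  simp only [id]
  rw [hnorm]
  calc ‖A - B‖ ≤ ‖A‖ + ‖B‖ := norm_sub_le _ _
    _ ≤ 4 * C * Real.exp (-T / 2) * π + 4 * C * Real.exp (-T / 2) * π := add_le_add hb1 hb2
    _ = 8 * C * π * Real.exp (-(T / 2)) := by rw [neg_div]; ring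

lemma Polynomial.integral_eval_strip (g : Polynomial ℂ) :
    ∫ t : ℝ, (g.eval (((π / 2 : ℝ) : ℂ) + t * Complex.I) / (Real.cosh t : ℂ)
      + g.eval (((-(π / 2) : ℝ) : ℂ) + t * Complex.I) / (Real.cosh t : ℂ))
      = 2 * π * g.eval 0 := by
  have hg (z : ℂ) : g.eval z = (X * g.divX).eval z + g.eval 0 := by
    conv_lhs => rw [← g.X_mul_divX_add]
    simp [Polynomial.coeff_zero_eq_eval_zero]
  have hc : Integrable fun t : ℝ ↦ 2 * g.eval 0 * (((Real.cosh t)⁻¹ : ℝ) : ℂ) := by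
    have := ((C (2 * g.eval 0)).integrable_eval_add_mul_I_div_cosh 0)
    refine this.congr (.of_forall fun t ↦ ?_)
    simp [div_eq_mul_inv]
  have hi (x : ℝ) := (X * g.divX).integrable_eval_add_mul_I_div_cosh x
  have hval : ∫ t : ℝ, 2 * g.eval 0 * (((Real.cosh t)⁻¹ : ℝ) : ℂ) = 2 * π * g.eval 0 := by
    rw [integral_const_mul, integral_complex_ofReal, Real.integral_inv_cosh]
    ring
  have hadd := integral_add ((hi (π / 2)).add (hi (-(π / 2)))) hc
  simp only [Pi.add_apply] at hadd
  rw [g.divX.integral_eval_strip_X_mul, hval, zero_add] at hadd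
  rw [← hadd]
  refine integral_congr_ae (.of_forall fun t ↦ ?_)
  dsimp only
  rw [hg (((π / 2 : ℝ) : ℂ) + t * Complex.I), hg (((-(π / 2) : ℝ) : ℂ) + t * Complex.I),
    Complex.ofReal_inv]
  ring

theorem stmt_9 (g : Polynomial ℂ) :
    (1 / (2 * π)) * ∫ t : ℝ,
        ((g.eval ((π / 2 : ℝ) + t * Complex.I)).re
          + (g.eval (-(π / 2 : ℝ) + t * Complex.I)).re) / Real.cosh t
      = (g.eval 0).re := by
  have hi (x : ℝ) := g.integrable_eval_add_mul_I_div_cosh x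
  have h := integral_re ((hi (π / 2)).add (hi (-(π / 2))))
  simp only [Pi.add_apply] at h
  rw [g.integral_eval_strip] at h
  have hre : (2 * π * g.eval 0 : ℂ).re = 2 * π * (g.eval 0).re := by
    rw [← Complex.re_ofReal_mul]
    push_cast
    rfl
  rw [RCLike.re_eq_complex_re, hre] at h
  have hπ := Real.pi_pos.ne'
  rw [one_div, inv_mul_eq_iff_eq_mul₀ (by positivity), ← h]
  refine integral_congr_ae (.of_forall fun t ↦ ?_)
  simp only [Complex.add_re, Complex.div_ofReal_re, Complex.ofReal_neg]
  ring
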